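/- Let (X, f_{1,∞}) be a finitely generated non-autonomous discrete system on a compact metric space X. If f_{1,∞} is minimal in the sense that every point of X has dense orbit, and f_{1,∞} is commutative, then f_{1,∞} is either sensitive or equicontinuous. -/

import Mathlib

/-- `compSeq f i n = f (i+n-1) ∘ ⋯ ∘ f i` (0-based indexing; `compSeq f 0 n = f_1^n`). -/
def compSeq {X : Type*} (f : ℕ → X → X) (i : ℕ) : ℕ → X → X
  | 0 => id
  | n + 1 => f (i + n) ∘ compSeq f i n

/-- Orbit of `x` under the non-autonomous system: `{f_1^n(x) : n ≥ 0}`. -/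
def NDSOrbit {X : Type*} (f : ℕ → X → X) (x : X) : Set X :=
  Set.range fun n => compSeq f 0 n x

/-- Sensitivity of an NDS. -/
def NDSSensitive {X : Type*} [MetricSpace X] (f : ℕ → X → X) : Prop :=
  ∃ δ > (0 : ℝ), ∀ U : Set X, IsOpen U → U.Nonempty →
    ∃ x ∈ U, ∃ y ∈ U, ∃ n : ℕ, 0 < n ∧ δ < dist (compSeq f 0 n x) (compSeq f 0 n y)

/-- `x` is an equicontinuity point of the NDS. -/
def NDSEquicontinuityPt {X : Type*} [MetricSpace X] (f : ℕ → X → X) (x : X) : Prop :=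
  ∀ ε > (0 : ℝ), ∃ δ > (0 : ℝ), ∀ y : X, dist x y < δ →
    ∀ n : ℕ, dist (compSeq f 0 n x) (compSeq f 0 n y) < ε

open scoped Uniformity in
/-- Finitely many uniformly continuous maps admit a common modulus of continuity. -/
theorem exists_common_modulus {X ι : Type*} [PseudoMetricSpace X] (F : ι → X → X)
    (hF : ∀ k, UniformContinuous (F k)) (K : Finset ι) {ε : ℝ} (hε : 0 < ε) :
    ∃ δ > 0, ∀ a b : X, dist a b < δ → ∀ k ∈ K, dist (F k a) (F k b) < ε := by
  have h : ∀ᶠ p : X × X in 𝓤 X, ∀ k ∈ K, dist (F k p.1) (F k p.2) < ε :=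
    (Filter.eventually_all_finset K).2 fun k _ => hF k (Metric.dist_mem_uniformity hε)
  obtain ⟨δ, hδ, h⟩ := Metric.mem_uniformity_dist.1 h
  exact ⟨δ, hδ, fun a b hab => h hab⟩

theorem continuous_compSeq {X : Type*} [TopologicalSpace X] {f : ℕ → X → X}
    (hcont : ∀ n, Continuous (f n)) (i n : ℕ) : Continuous (compSeq f i n) := by
  induction n with
  | zero => exact continuous_id
  | succ n ih => exact (hcont _).comp ih

theorem Function.Commute.compSeq_right {X : Type*} {f : ℕ → X → X} {g : X → X}
    (h : ∀ j, Function.Commute g (f j)) (i n : ℕ) : Function.Commute g (compSeq f i n) := by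
  induction n with
  | zero => exact Function.Semiconj.id_right
  | succ n ih => exact (h _).comp_right ih

theorem compSeq_commute {X : Type*} {f : ℕ → X → X} (hcomm : ∀ i j, f i ∘ f j = f j ∘ f i)
    (i m n : ℕ) : Function.Commute (compSeq f i m) (compSeq f i n) :=
  have h (j : ℕ) : Function.Commute (f j) (compSeq f i m) :=
    Function.Commute.compSeq_right (f := f) (fun k w => congrFun (hcomm j k) w) i m
  Function.Commute.compSeq_right (fun j => (h j).symm) i n

/-- In a minimal commutative system that is not sensitive, finitely many of the maps
`f_1^k` provide approximate inverses, uniformly on the space, of all the maps `f_1^n`. -/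
theorem exists_finset_approx_inverse {X : Type*} [MetricSpace X] [CompactSpace X]
    {f : ℕ → X → X} (hcont : ∀ n, Continuous (f n))
    (hmin : ∀ x : X, Dense (NDSOrbit f x))
    (hcomm : ∀ i j, f i ∘ f j = f j ∘ f i) (hsens : ¬ NDSSensitive f)
    {ε : ℝ} (hε : 0 < ε) :
    ∃ K : Finset ℕ, ∀ n, ∃ k ∈ K, ∀ w : X,
      dist (compSeq f 0 k (compSeq f 0 n w)) w ≤ ε := by
  unfold NDSSensitive at hsens
  push Not at hsens
  obtain ⟨V, hVo, ⟨y, hyV⟩, hV⟩ := hsens ε hε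
  set U := V ∩ Metric.ball y ε
  have hUo : IsOpen U := hVo.inter Metric.isOpen_ball
  have hyU : y ∈ U := ⟨hyV, Metric.mem_ball_self hε⟩
  have hsmall : ∀ x ∈ U, ∀ n, dist (compSeq f 0 n x) (compSeq f 0 n y) ≤ ε := by
    intro x hx n
    rcases Nat.eq_zero_or_pos n with rfl | hn
    · exact (Metric.mem_ball.1 hx.2).le
    · exact hV x hx.1 y hyV n hn
  obtain ⟨K, hK⟩ := isCompact_univ.elim_finite_subcover (fun k => compSeq f 0 k ⁻¹' U)
    (fun k => hUo.preimage (continuous_compSeq hcont 0 k)) (by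
      intro x _
      obtain ⟨_, hz, k, rfl⟩ := (hmin x).inter_open_nonempty U hUo ⟨y, hyU⟩
      exact Set.mem_iUnion.2 ⟨k, hz⟩)
  refine ⟨K, fun n => ?_⟩
  obtain ⟨k, hk, hkU⟩ := Set.mem_iUnion₂.1 (hK (Set.mem_univ (compSeq f 0 n y)))
  refine ⟨k, hk, ?_⟩
  have hclosed : IsClosed {w : X | dist (compSeq f 0 k (compSeq f 0 n w)) w ≤ ε} :=
    isClosed_le (((continuous_compSeq hcont 0 k).comp
      (continuous_compSeq hcont 0 n)).dist continuous_id) continuous_const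
  have hsub : NDSOrbit f y ⊆ {w : X | dist (compSeq f 0 k (compSeq f 0 n w)) w ≤ ε} := by
    rintro _ ⟨m, rfl⟩
    have h := hsmall _ hkU m
    rwa [(compSeq_commute hcomm 0 m k).eq, (compSeq_commute hcomm 0 m n).eq] at h
  intro w
  exact hclosed.closure_subset_iff.2 hsub (hmin y w)

/-- a finitely generated, commutative NDS on a compact metric space
which is minimal (every orbit dense) is either sensitive or equicontinuous. -/
theorem stmt8 {X : Type*} [MetricSpace X] [CompactSpace X]
    (f : ℕ → X → X) (hcont : ∀ n, Continuous (f n))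
    (hfin : (Set.range f).Finite)
    (hmin : ∀ x : X, Dense (NDSOrbit f x))
    (hcomm : ∀ i j, f i ∘ f j = f j ∘ f i) :
    NDSSensitive f ∨ ∀ x : X, NDSEquicontinuityPt f x := by
  refine or_iff_not_imp_left.2 fun hsens x ε hε => ?_
  have hη : 0 < ε / 8 := by positivity
  obtain ⟨K, hK⟩ := exists_finset_approx_inverse hcont hmin hcomm hsens hη
  obtain ⟨δ, hδ, hKδ⟩ := exists_common_modulus (compSeq f 0)
    (fun k => CompactSpace.uniformContinuous_of_continuous (continuous_compSeq hcont 0 k)) K hη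
  obtain ⟨L, hL⟩ := exists_finset_approx_inverse hcont hmin hcomm hsens (half_pos hδ)
  refine ⟨δ, hδ, fun y hxy n => ?_⟩
  obtain ⟨l, -, hl⟩ := hL n
  obtain ⟨k, hk, hkl⟩ := hK l
  have happrox : ∀ w, dist (compSeq f 0 n w) (compSeq f 0 k w) < ε / 8 + ε / 8 := by
    intro w
    refine (dist_triangle_left _ _ _).trans_lt (add_lt_add_of_le_of_lt (hkl (compSeq f 0 n w)) ?_)
    exact hKδ _ _ ((hl w).trans_lt (half_lt_self hδ)) k hk
  have h1 := happrox x
  have h2 := happrox y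
  rw [dist_comm] at h2
  linarith [hKδ x y hxy k hk, dist_triangle4 (compSeq f 0 n x) (compSeq f 0 k x)
    (compSeq f 0 k y) (compSeq f 0 n y)]
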